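/- Let p be a prime and let R be a noetherian complete local ring with maximal ideal 𝔪 and perfect residue field k of characteristic p. Let 𝔟 ⊆ 𝔪 be a nilpotent ideal and R' = R/𝔟. Then the projection W(R) → W(R') maps 𝕎(R) surjectively onto 𝕎(R'), and the kernel of the induced map 𝕎(R) → 𝕎(R') equals Ŵ(𝔟) = W(𝔟) ∩ Ŵ(𝔪). -/

import Mathlib

open WittVector in
/-- `x ∈ Ŵ(𝔟)`: all coefficients of the Witt vector `x` lie in `𝔟` and converge to zero
`𝔪`-adically (for every `n`, all but finitely many coefficients lie in `𝔪^n`). -/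
def MemHatW (p : ℕ) [Fact p.Prime] {R : Type} [CommRing R] (𝔪 𝔟 : Ideal R)
    (x : WittVector p R) : Prop :=
  (∀ i, x.coeff i ∈ 𝔟) ∧ ∀ n : ℕ, ∀ᶠ i in Filter.atTop, x.coeff i ∈ 𝔪 ^ n

open WittVector in
/-- `T` is the subring `𝕎(R) ⊆ W(R)`: it is stable under the Frobenius, maps
surjectively onto `W(k)` under the projection (induced by the residue map `ρ : R → k`),
and the kernel of `T → W(k)` is `Ŵ(𝔪)`. -/
def IsSpecialSubring (p : ℕ) [Fact p.Prime] {R k : Type} [CommRing R] [CommRing k]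
    (𝔪 : Ideal R) (ρ : R →+* k) (T : Subring (WittVector p R)) : Prop :=
  (∀ x ∈ T, frobenius x ∈ T) ∧
  (∀ y : WittVector p k, ∃ x ∈ T, WittVector.map ρ x = y) ∧
  (∀ x : WittVector p R, (x ∈ T ∧ WittVector.map ρ x = 0) ↔ MemHatW p 𝔪 𝔪 x)

open WittVector

theorem MvPolynomial.aeval_mem_of_constantCoeff_eq_zero {σ R : Type*} [CommRing R] (I : Ideal R)
    {x : σ → R} (hx : ∀ i, x i ∈ I) {P : MvPolynomial σ ℤ}
    (hP : MvPolynomial.constantCoeff P = 0) : MvPolynomial.aeval x P ∈ I := by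
  rw [← Ideal.Quotient.eq_zero_iff_mem, ← Ideal.Quotient.mkₐ_eq_mk ℤ,
    MvPolynomial.comp_aeval_apply]
  have h : (fun i => Ideal.Quotient.mkₐ ℤ I (x i)) = 0 := by
    funext i
    simpa using Ideal.Quotient.eq_zero_iff_mem.2 (hx i)
  rw [h, MvPolynomial.aeval_zero, hP, map_zero]

theorem WittVector.map_eq_zero_iff_coeff_mem_ker (p : ℕ) [Fact p.Prime] {R S : Type*} [CommRing R]
    [CommRing S] (φ : R →+* S) (x : WittVector p R) :
    WittVector.map φ x = 0 ↔ ∀ i, x.coeff i ∈ RingHom.ker φ := by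
  simp [WittVector.ext_iff, RingHom.mem_ker]

theorem WittVector.map_mk_eq_zero_iff (p : ℕ) [Fact p.Prime] {R : Type*} [CommRing R]
    (I : Ideal R) (x : WittVector p R) :
    WittVector.map (Ideal.Quotient.mk I) x = 0 ↔ ∀ i, x.coeff i ∈ I := by
  rw [map_eq_zero_iff_coeff_mem_ker, Ideal.mk_ker]

theorem WittVector.constantCoeff_frobeniusPolyAux (p : ℕ) [Fact p.Prime] (n : ℕ) :
    MvPolynomial.constantCoeff (frobeniusPolyAux p n) = 0 := by
  have h0 := coeff_frobenius (0 : WittVector p ℤ) n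
  have hc : (0 : WittVector p ℤ).coeff = 0 := funext fun i => zero_coeff p ℤ i
  rw [map_zero, zero_coeff, hc, MvPolynomial.aeval_zero] at h0
  have hp : p ≠ 0 := (Fact.out : p.Prime).ne_zero
  simpa [frobeniusPoly, hp] using h0

/-- The Frobenius maps `W(I)` to `W(𝔪 I)` if `p ∈ 𝔪` and `I ⊆ 𝔪`. -/
theorem WittVector.coeff_frobenius_mem_mul (p : ℕ) [Fact p.Prime] {R : Type*} [CommRing R]
    {𝔪 I : Ideal R} (hp : (p : R) ∈ 𝔪) (hI : I ≤ 𝔪) {x : WittVector p R}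
    (hx : ∀ i, x.coeff i ∈ I) (n : ℕ) : (frobenius x).coeff n ∈ 𝔪 * I := by
  rw [coeff_frobenius, frobeniusPoly, map_add, map_mul, map_pow, MvPolynomial.aeval_X]
  refine add_mem ?_ ?_
  · obtain ⟨q, hq⟩ := Nat.exists_eq_add_of_le (Fact.out : p.Prime).two_le
    have h : x.coeff n ^ p = x.coeff n ^ q * (x.coeff n * x.coeff n) := by
      rw [← sq, ← pow_add, add_comm, ← hq]
    rw [h]
    exact Ideal.mul_mem_left _ _ (Ideal.mul_mem_mul (hI (hx n)) (hx n))
  · refine Ideal.mul_mem_mul ?_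
      (MvPolynomial.aeval_mem_of_constantCoeff_eq_zero I hx (constantCoeff_frobeniusPolyAux p n))
    simpa using hp

theorem WittVector.coeff_iterate_frobenius_mem_pow (p : ℕ) [Fact p.Prime] {R : Type*} [CommRing R]
    {𝔪 : Ideal R} (hp : (p : R) ∈ 𝔪) {x : WittVector p R} (hx : ∀ i, x.coeff i ∈ 𝔪) (n : ℕ) :
    ∀ i, (frobenius^[n] x).coeff i ∈ 𝔪 ^ (n + 1) := by
  induction n with
  | zero => simpa using hx
  | succ n ih =>
    intro i
    rw [Function.iterate_succ_apply', pow_succ']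
    exact coeff_frobenius_mem_mul p hp (Ideal.pow_le_self n.succ_ne_zero) ih i

theorem WittVector.map_iterate_frobenius (p : ℕ) [Fact p.Prime] {R S : Type*} [CommRing R]
    [CommRing S] (φ : R →+* S) (n : ℕ) (x : WittVector p R) :
    WittVector.map φ (frobenius^[n] x) = frobenius^[n] (WittVector.map φ x) := by
  have h : Function.Semiconj (WittVector.map φ : WittVector p R → WittVector p S)
      frobenius frobenius := by
    intro x
    ext i
    rw [map_coeff, coeff_frobenius, coeff_frobenius]
    have hc : (WittVector.map φ x).coeff = fun i => φ.toIntAlgHom (x.coeff i) :=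
      funext fun i => map_coeff φ x i
    rw [hc, ← MvPolynomial.comp_aeval_apply]
    rfl
  exact h.iterate_right n x

theorem IsSpecialSubring.iterate_frobenius_mem {p : ℕ} [Fact p.Prime] {R k : Type} [CommRing R]
    [CommRing k] {𝔪 : Ideal R} {ρ : R →+* k} {T : Subring (WittVector p R)}
    (hT : IsSpecialSubring p 𝔪 ρ T) {x : WittVector p R} (hx : x ∈ T) (n : ℕ) :
    frobenius^[n] x ∈ T := by
  induction n with
  | zero => exact hx
  | succ n ih =>
    rw [Function.iterate_succ_apply']
    exact hT.1 _ ih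

/-- A special subring of `W(R)` is contained in any other one. -/
theorem IsSpecialSubring.le {p : ℕ} [Fact p.Prime] {R k : Type} [CommRing R] [CommRing k]
    [CharP k p] [PerfectRing k p] {𝔪 : Ideal R} {ρ : R →+* k} (hker : RingHom.ker ρ = 𝔪)
    {T₁ T₂ : Subring (WittVector p R)} (h₁ : IsSpecialSubring p 𝔪 ρ T₁)
    (h₂ : IsSpecialSubring p 𝔪 ρ T₂) : T₁ ≤ T₂ := by
  have hp : (p : R) ∈ 𝔪 := by simp [← hker, RingHom.mem_ker]
  have hW : ∀ x : WittVector p R, WittVector.map ρ x = 0 → ∀ i, x.coeff i ∈ 𝔪 := fun x hx =>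
    hker ▸ (map_eq_zero_iff_coeff_mem_ker p ρ x).1 hx
  intro x hx
  obtain ⟨y, hy, hxy⟩ := h₂.2.1 (WittVector.map ρ x)
  suffices h : MemHatW p 𝔪 𝔪 (x - y) by
    simpa using add_mem ((h₂.2.2 _).2 h).1 hy
  refine ⟨hW _ (by simp [hxy]), fun n => ?_⟩
  obtain ⟨w, hw⟩ := ((frobenius_bijective p k).surjective.iterate n) (WittVector.map ρ x)
  obtain ⟨u, hu, huw⟩ := h₁.2.1 w
  obtain ⟨v, hv, hvw⟩ := h₂.2.1 w
  have ha : MemHatW p 𝔪 𝔪 (x - frobenius^[n] u) :=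
    (h₁.2.2 _).1 ⟨sub_mem hx (h₁.iterate_frobenius_mem hu n), by
      rw [map_sub, map_iterate_frobenius, huw, hw, sub_self]⟩
  have hb : MemHatW p 𝔪 𝔪 (y - frobenius^[n] v) :=
    (h₂.2.2 _).1 ⟨sub_mem hy (h₂.iterate_frobenius_mem hv n), by
      rw [map_sub, map_iterate_frobenius, hvw, hw, hxy, sub_self]⟩
  have hab : MemHatW p 𝔪 𝔪 ((x - frobenius^[n] u) - (y - frobenius^[n] v)) := by
    have ha' := (h₁.2.2 _).2 ha
    have hb' := (h₁.2.2 _).2 hb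
    exact (h₁.2.2 _).1 ⟨sub_mem ha'.1 hb'.1, by rw [map_sub, ha'.2, hb'.2, sub_self]⟩
  have huv : WittVector.map (Ideal.Quotient.mk (𝔪 ^ n)) (frobenius^[n] (u - v)) = 0 :=
    (map_mk_eq_zero_iff p _ _).2 fun i => Ideal.pow_le_pow_right n.le_succ
      (coeff_iterate_frobenius_mem_pow p hp (hW _ (by rw [map_sub, huw, hvw, sub_self])) n i)
  have heq : WittVector.map (Ideal.Quotient.mk (𝔪 ^ n)) (x - y) =
      WittVector.map (Ideal.Quotient.mk (𝔪 ^ n))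
        ((x - frobenius^[n] u) - (y - frobenius^[n] v)) := by
    rw [iterate_map_sub, map_sub, sub_eq_zero] at huv
    simp only [map_sub, huv]
    ring
  filter_upwards [hab.2 n] with i hi
  rw [← Ideal.Quotient.eq_zero_iff_mem, ← map_coeff] at hi ⊢
  rw [heq, hi]

/-- Null sequences in `φ(𝔪)` lift to null sequences in `𝔪` along a surjection `φ`. -/
theorem MemHatW.exists_lift {p : ℕ} [Fact p.Prime] {R S : Type} [CommRing R] [CommRing S]
    {φ : R →+* S} (hφ : Function.Surjective φ) {𝔪 : Ideal R} {y : WittVector p S}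
    (hy : MemHatW p (𝔪.map φ) (𝔪.map φ) y) :
    ∃ x : WittVector p R, MemHatW p 𝔪 𝔪 x ∧ WittVector.map φ x = y := by
  classical
  have lift_pow : ∀ (n : ℕ) (s : S), s ∈ 𝔪.map φ ^ n → ∃ r ∈ 𝔪 ^ n, φ r = s := by
    intro n s hs
    rw [← Ideal.map_pow] at hs
    exact (Ideal.mem_map_iff_of_surjective φ hφ).1 hs
  have lift_coeff : ∀ i, ∃ r ∈ 𝔪, φ r = y.coeff i ∧
      ∀ n ≤ i, y.coeff i ∈ 𝔪.map φ ^ n → r ∈ 𝔪 ^ n := by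
    intro i
    let m := Nat.findGreatest (fun n => y.coeff i ∈ 𝔪.map φ ^ n) i
    have hm : y.coeff i ∈ 𝔪.map φ ^ m :=
      Nat.findGreatest_spec (P := fun n => y.coeff i ∈ 𝔪.map φ ^ n) (Nat.zero_le i) (by simp)
    by_cases h0 : m = 0
    · obtain ⟨r, hr, hri⟩ := lift_pow 1 _ (by simpa using hy.1 i)
      refine ⟨r, by simpa using hr, hri, fun n hn hyn => ?_⟩
      have : n ≤ m := Nat.le_findGreatest hn hyn
      obtain rfl : n = 0 := by omega
      simp
    · obtain ⟨r, hr, hri⟩ := lift_pow m _ hm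
      exact ⟨r, Ideal.pow_le_self h0 hr, hri, fun n hn hyn =>
        Ideal.pow_le_pow_right (Nat.le_findGreatest hn hyn) hr⟩
  choose r hr hri hrn using lift_coeff
  refine ⟨WittVector.mk p r, ⟨fun i => by simpa using hr i, fun n => ?_⟩, ?_⟩
  · filter_upwards [hy.2 n, Filter.eventually_ge_atTop n] with i hi hni
    simpa using hrn i n hni hi
  · ext i
    simpa using hri i

/-- The image of a special subring under a surjection of rings over `k` is special. -/
theorem IsSpecialSubring.map {p : ℕ} [Fact p.Prime] {R S k : Type} [CommRing R] [CommRing S]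
    [CommRing k] {𝔪 : Ideal R} {φ : R →+* S} (hφ : Function.Surjective φ) {ρ : R →+* k}
    {ρ' : S →+* k} (hρ : ρ'.comp φ = ρ) {T : Subring (WittVector p R)}
    (hT : IsSpecialSubring p 𝔪 ρ T) :
    IsSpecialSubring p (𝔪.map φ) ρ' (T.map (WittVector.map φ)) := by
  have hmap : ∀ x : WittVector p R,
      WittVector.map ρ' (WittVector.map φ x) = WittVector.map ρ x := by
    intro x
    ext i
    simp [← hρ]
  refine ⟨?_, fun y => ?_, fun y => ⟨?_, fun hy => ?_⟩⟩
  · rintro _ ⟨x, hx, rfl⟩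
    exact ⟨frobenius x, hT.1 x hx, map_iterate_frobenius p φ 1 x⟩
  · obtain ⟨x, hx, rfl⟩ := hT.2.1 y
    exact ⟨WittVector.map φ x, ⟨x, hx, rfl⟩, hmap x⟩
  · rintro ⟨⟨x, hx, rfl⟩, h0⟩
    have h := (hT.2.2 x).1 ⟨hx, by rw [← hmap, h0]⟩
    refine ⟨fun i => ?_, fun n => ?_⟩
    · rw [map_coeff]
      exact Ideal.mem_map_of_mem φ (h.1 i)
    · filter_upwards [h.2 n] with i hi
      rw [map_coeff, ← Ideal.map_pow]
      exact Ideal.mem_map_of_mem φ hi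
  · obtain ⟨x, hx, rfl⟩ := hy.exists_lift hφ
    have h := (hT.2.2 x).2 hx
    exact ⟨⟨x, h.1, rfl⟩, by rw [hmap, h.2]⟩

open WittVector in
/-- For a nilpotent ideal `𝔟 ⊆ 𝔪` and `R' = R/𝔟`, the projection
`W(R) → W(R')` maps `𝕎(R)` surjectively onto `𝕎(R')` with kernel `Ŵ(𝔟) = W(𝔟) ∩ Ŵ(𝔪)`. -/
theorem special_subring_quotient (p : ℕ) [Fact p.Prime]
    (R : Type) [CommRing R] [IsLocalRing R] [IsNoetherianRing R]
    [IsAdicComplete (IsLocalRing.maximalIdeal R) R]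
    (k : Type) [Field k] [CharP k p] [PerfectRing k p]
    (ρ : R →+* k) (hρ : Function.Surjective ρ)
    (hker : RingHom.ker ρ = IsLocalRing.maximalIdeal R)
    (𝔟 : Ideal R) (h𝔟 : 𝔟 ≤ IsLocalRing.maximalIdeal R) (hnil : ∃ m : ℕ, 𝔟 ^ m = ⊥)
    (T : Subring (WittVector p R))
    (hT : IsSpecialSubring p (IsLocalRing.maximalIdeal R) ρ T)
    (T' : Subring (WittVector p (R ⧸ 𝔟)))
    (hT' : IsSpecialSubring p ((IsLocalRing.maximalIdeal R).map (Ideal.Quotient.mk 𝔟))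
      (Ideal.Quotient.lift 𝔟 ρ (fun a ha => by
        rw [← RingHom.mem_ker, hker]; exact h𝔟 ha)) T') :
    T.map (WittVector.map (Ideal.Quotient.mk 𝔟)) = T' ∧
    (∀ x : WittVector p R,
      (x ∈ T ∧ WittVector.map (Ideal.Quotient.mk 𝔟) x = 0)
        ↔ MemHatW p (IsLocalRing.maximalIdeal R) 𝔟 x) := by
  constructor
  · have hker' : RingHom.ker (Ideal.Quotient.lift 𝔟 ρ (fun a ha => by
        rw [← RingHom.mem_ker, hker]; exact h𝔟 ha)) =
        (IsLocalRing.maximalIdeal R).map (Ideal.Quotient.mk 𝔟) :=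
      (Ideal.ker_quotient_lift ρ (h𝔟.trans hker.ge)).trans (by rw [hker])
    have hmap := hT.map (φ := Ideal.Quotient.mk 𝔟) Ideal.Quotient.mk_surjective
      (ρ' := Ideal.Quotient.lift 𝔟 ρ (fun a ha => by
        rw [← RingHom.mem_ker, hker]; exact h𝔟 ha)) (Ideal.Quotient.lift_comp_mk _ _ _)
    exact le_antisymm (hmap.le hker' hT') (hT'.le hker' hmap)
  · intro x
    constructor
    · rintro ⟨hx, h0⟩
      have hb := (map_mk_eq_zero_iff p 𝔟 x).1 h0
      exact ⟨hb, ((hT.2.2 x).1 ⟨hx, (map_eq_zero_iff_coeff_mem_ker p ρ x).2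
        fun i => hker ▸ h𝔟 (hb i)⟩).2⟩
    · intro h
      exact ⟨((hT.2.2 x).2 ⟨fun i => h𝔟 (h.1 i), h.2⟩).1, (map_mk_eq_zero_iff p 𝔟 x).2 h.1⟩
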